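/- arXiv:2001.05516 — 3 statements merged into one kernel-verified Lean document; each statement's English description precedes it below -/
import Mathlib

section
/- Let (X,d) be a metric space, f : X → X a map, γ : [0,1] → X a continuous path with image I = γ([0,1]), and let L > 0, ε > 0 and an integer n ≥ 1 be given. Assume that for every 0 ≤ i ≤ n−1 the total variation of the path f^i ∘ γ on [0,1] is at most L. Then every (n,ε)-separated subset of I is finite of cardinality at most n(L/ε + 1); consequently there exists an (n,ε)-spanning set of I of cardinality at most n(L/ε + 1). -/
open Set

/-- A finite set `F` `(n,ε)`-spans `K` for the map `f`: every point of `K` lies in the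
dynamical ball `B(x,n,ε)` of some `x ∈ F`. -/
def Spans {X : Type*} [MetricSpace X] (f : X → X) (K : Set X) (F : Finset X)
    (n : ℕ) (ε : ℝ) : Prop :=
  ∀ y ∈ K, ∃ x ∈ F, ∀ i < n, dist (f^[i] x) (f^[i] y) < ε

/-- A set `E ⊆ K` is `(n,ε)`-separated for the map `f`. -/
def Separated {X : Type*} [MetricSpace X] (f : X → X) (K E : Set X)
    (n : ℕ) (ε : ℝ) : Prop :=
  E ⊆ K ∧ ∀ x ∈ E, ∀ y ∈ E, x ≠ y → ∃ i < n, ε < dist (f^[i] x) (f^[i] y)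

/-- If any two points of a finite set `T ⊆ s` of parameters are `ε`-apart under one of the `n`
maps `g i`, each of variation at most `L` on `s`, then `(#T - 1) ε ≤ n L`. -/
theorem card_mul_le_of_eVariationOn_le {α X : Type*} [LinearOrder α] [PseudoEMetricSpace X]
    (g : ℕ → α → X) (s : Set α) (n : ℕ) (L ε : ENNReal)
    (hvar : ∀ i < n, eVariationOn (g i) s ≤ L) (T : Finset α) (hTs : ↑T ⊆ s)
    (hsep : ∀ x ∈ T, ∀ y ∈ T, x ≠ y → ∃ i < n, ε ≤ edist (g i x) (g i y))
    (k : ℕ) (hk : T.card = k + 1) : (k : ENNReal) * ε ≤ n * L := by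
  set u : ℕ → α := fun j => T.orderEmbOfFin hk ⟨min j k, by omega⟩ with hu
  have hmono : Monotone u := fun a b hab => by
    apply (T.orderEmbOfFin hk).monotone
    simp only [Fin.mk_le_mk]
    omega
  have huT : ∀ j, u j ∈ T := fun j => T.orderEmbOfFin_mem hk _
  have hstep : ∀ j ∈ Finset.range k,
      ε ≤ ∑ i ∈ Finset.range n, edist (g i (u (j + 1))) (g i (u j)) := by
    intro j hj
    have hj := Finset.mem_range.1 hj
    have hne : u (j + 1) ≠ u j := fun h => by
      have := (T.orderEmbOfFin hk).injective h
      simp only [Fin.mk.injEq] at this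
      omega
    obtain ⟨i, hi, h⟩ := hsep _ (huT _) _ (huT _) hne
    exact h.trans (Finset.single_le_sum (f := fun i => edist (g i (u (j + 1))) (g i (u j)))
      (fun _ _ => zero_le) (Finset.mem_range.2 hi))
  calc (k : ENNReal) * ε = ∑ _j ∈ Finset.range k, ε := by simp
    _ ≤ ∑ j ∈ Finset.range k, ∑ i ∈ Finset.range n, edist (g i (u (j + 1))) (g i (u j)) :=
      Finset.sum_le_sum hstep
    _ = ∑ i ∈ Finset.range n, ∑ j ∈ Finset.range k, edist (g i (u (j + 1))) (g i (u j)) :=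
      Finset.sum_comm
    _ ≤ ∑ _i ∈ Finset.range n, L := Finset.sum_le_sum fun i hi =>
      (eVariationOn.sum_le hmono fun j => hTs (huT j)).trans (hvar i (Finset.mem_range.1 hi))
    _ = n * L := by simp

/-- Cardinality bound for finite subsets of a path whose points are pairwise at dynamical distance
at least `ε`. -/
theorem card_le_of_weakly_separated {X : Type*} [MetricSpace X] (f : X → X) (γ : ℝ → X)
    (s : Set ℝ) (L ε : ℝ) (hL : 0 < L) (hε : 0 < ε) (n : ℕ) (hn : 1 ≤ n)
    (hvar : ∀ i < n, eVariationOn (f^[i] ∘ γ) s ≤ ENNReal.ofReal L)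
    (F : Finset X) (hF : ↑F ⊆ γ '' s)
    (hsep : ∀ x ∈ F, ∀ y ∈ F, x ≠ y → ∃ i < n, ε ≤ dist (f^[i] x) (f^[i] y)) :
    (F.card : ℝ) ≤ n * (L / ε + 1) := by
  classical
  obtain ⟨T, hTs, rfl, hcard⟩ : ∃ T : Finset ℝ, ↑T ⊆ s ∧ T.image γ = F ∧ F.card = T.card := by
    choose! t ht hγt using hF
    refine ⟨F.image t, ?_, ?_, ?_⟩
    · intro x hx
      obtain ⟨y, hy, rfl⟩ := Finset.mem_image.1 (Finset.mem_coe.1 hx)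
      exact ht hy
    · rw [Finset.image_image]
      exact (Finset.image_congr fun x hx => hγt hx).trans Finset.image_id
    · exact (Finset.card_image_of_injOn fun x hx y hy h => by
        rw [← hγt hx, ← hγt hy, h]).symm
  have hn' : (1 : ℝ) ≤ n := by exact_mod_cast hn
  rw [hcard]
  have hinj : InjOn γ T := Finset.card_image_iff.1 hcard
  rcases hk : T.card with _ | k
  · push_cast
    positivity
  have key := card_mul_le_of_eVariationOn_le (fun i => f^[i] ∘ γ) s n _ (ENNReal.ofReal ε) hvar T
    hTs (fun x hx y hy hxy => by
      obtain ⟨i, hi, h⟩ := hsep _ (Finset.mem_image_of_mem γ hx) _ (Finset.mem_image_of_mem γ hy)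
        (fun h => hxy (hinj hx hy h))
      exact ⟨i, hi, by rw [edist_dist]; exact ENNReal.ofReal_le_ofReal h⟩) k hk
  rw [← ENNReal.ofReal_natCast, ← ENNReal.ofReal_natCast, ← ENNReal.ofReal_mul (by positivity),
    ← ENNReal.ofReal_mul (by positivity), ENNReal.ofReal_le_ofReal_iff (by positivity)] at key
  have hle : (k : ℝ) ≤ n * (L / ε) := by
    rw [← mul_div_assoc]
    exact (le_div_iff₀ hε).2 key
  push_cast
  linarith

/-- If `γ : [0,1] → X` is a continuous path with image `I` and for every `0 ≤ i ≤ n-1` the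
total variation of `f^i ∘ γ` is at most `L`, then every `(n,ε)`-separated subset of `I` is
finite with cardinality at most `n (L/ε + 1)`, and there is an `(n,ε)`-spanning set of `I`
of cardinality at most `n (L/ε + 1)`. -/
theorem stmt0 {X : Type*} [MetricSpace X] (f : X → X) (γ : ℝ → X)
    (hγ : ContinuousOn γ (Icc 0 1)) (I : Set X) (hI : I = γ '' Icc 0 1)
    (L ε : ℝ) (hL : 0 < L) (hε : 0 < ε) (n : ℕ) (hn : 1 ≤ n)
    (hvar : ∀ i < n, eVariationOn (f^[i] ∘ γ) (Icc 0 1) ≤ ENNReal.ofReal L) :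
    (∀ E : Set X, Separated f I E n ε →
        E.Finite ∧ (E.ncard : ℝ) ≤ n * (L / ε + 1)) ∧
      ∃ F : Finset X, Spans f I F n ε ∧ (F.card : ℝ) ≤ n * (L / ε + 1) := by
  classical
  subst hI
  have bound := card_le_of_weakly_separated f γ (Icc 0 1) L ε hL hε n hn hvar
  constructor
  · rintro E ⟨hEI, hE⟩
    have hsub : ∀ F : Finset X, ↑F ⊆ E → (F.card : ℝ) ≤ n * (L / ε + 1) := fun F hF =>
      bound F (hF.trans hEI) fun x hx y hy hxy =>
        let ⟨i, hi, h⟩ := hE x (hF hx) y (hF hy) hxy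
        ⟨i, hi, h.le⟩
    have hfin : E.Finite := by
      by_contra hinf
      obtain ⟨m, hm⟩ := exists_nat_gt ((n : ℝ) * (L / ε + 1))
      obtain ⟨F, hF, rfl⟩ := Set.Infinite.exists_subset_card_eq hinf m
      exact absurd (hsub F hF) (not_le.2 hm)
    refine ⟨hfin, ?_⟩
    rw [Set.ncard_eq_toFinset_card E hfin]
    exact hsub _ (by simp)
  · set S : Set ℕ := {k | ∃ F : Finset X, ↑F ⊆ γ '' Icc 0 1 ∧
      (∀ x ∈ F, ∀ y ∈ F, x ≠ y → ∃ i < n, ε ≤ dist (f^[i] x) (f^[i] y)) ∧ F.card = k} with hS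
    have hbdd : BddAbove S := by
      refine ⟨⌊(n : ℝ) * (L / ε + 1)⌋₊, ?_⟩
      rintro _ ⟨F, hF, hsep, rfl⟩
      exact Nat.le_floor (bound F hF hsep)
    have hne : S.Nonempty := ⟨0, ∅, by simp, by simp, rfl⟩
    obtain ⟨F, hF, hsep, hcard⟩ := Nat.sSup_mem hne hbdd
    refine ⟨F, fun y hy => ?_, bound F hF hsep⟩
    by_contra! hcon
    have hyF : y ∉ F := fun h => by
      obtain ⟨i, -, hi⟩ := hcon y h
      rw [dist_self] at hi
      exact absurd hi (not_le.2 hε)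
    have hmem : F.card + 1 ∈ S := by
      refine ⟨insert y F, ?_, ?_, Finset.card_insert_of_notMem hyF⟩
      · rw [Finset.coe_insert]
        exact Set.insert_subset hy hF
      · intro a ha b hb hab
        rcases Finset.mem_insert.1 ha with rfl | haF <;>
          rcases Finset.mem_insert.1 hb with rfl | hbF
        · exact absurd rfl hab
        · obtain ⟨i, hi, h⟩ := hcon b hbF
          exact ⟨i, hi, by rwa [dist_comm]⟩
        · exact hcon a haF
        · exact hsep a haF b hbF hab
    have := le_csSup hbdd hmem
    omega
end

section
/- Let (X,d) be a metric space, f : X → X a uniformly continuous map, and γ : [0,1] → X a continuous path with image I = γ([0,1]). If there exists L > 0 such that for every integer n ≥ 0 the total variation of the path f^n ∘ γ on [0,1] is at most L, then the topological entropy of f on I is zero: h(f, I) = 0. -/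
open Set Filter

/-- `N(n,ε,K)`: the minimal cardinality of an `(n,ε)`-spanning set of `K`. -/
noncomputable def spanNum {X : Type*} [MetricSpace X] (f : X → X) (K : Set X)
    (n : ℕ) (ε : ℝ) : ℕ :=
  sInf {m : ℕ | ∃ F : Finset X, Spans f K F n ε ∧ F.card = m}

/-- The topological entropy of `f` on the set `K`:
`lim_{ε→0} limsup_n (1/n) log N(n,ε,K)`; since `N(n,ε,K)` is antitone in `ε`
the limit as `ε → 0` equals the supremum over `ε > 0`. -/
noncomputable def entropyOn {X : Type*} [MetricSpace X] (f : X → X) (K : Set X) : EReal :=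
  ⨆ (ε : ℝ) (_ : 0 < ε),
    Filter.atTop.limsup fun n : ℕ => ((Real.log (spanNum f K n ε) / n : ℝ) : EReal)

theorem LocallyBoundedVariationOn.dist_le_variationOnFromTo_sub {X : Type*} [PseudoMetricSpace X]
    {g : ℝ → X} {S : Set ℝ} (hg : LocallyBoundedVariationOn g S) {a b c : ℝ} (ha : a ∈ S)
    (hb : b ∈ S) (hc : c ∈ S) (hbc : b ≤ c) :
    dist (g b) (g c) ≤ variationOnFromTo g S a c - variationOnFromTo g S a b := by
  have hadd := variationOnFromTo.add hg ha hb hc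
  have hle : dist (g b) (g c) ≤ variationOnFromTo g S b c := by
    rw [variationOnFromTo.eq_of_le g S hbc, dist_edist]
    exact ENNReal.toReal_mono (hg b c hb hc)
      (eVariationOn.edist_le g ⟨hb, le_refl b, hbc⟩ ⟨hc, hbc, le_refl c⟩)
  linarith

theorem spanNum_le_of_eVariationOn_le {X : Type*} [MetricSpace X] (f : X → X) (γ : ℝ → X)
    {L : ℝ} (hL : 0 ≤ L)
    (hbound : ∀ n : ℕ, eVariationOn (f^[n] ∘ γ) (Icc 0 1) ≤ ENNReal.ofReal L)
    (n : ℕ) {ε : ℝ} (hε : 0 < ε) :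
    spanNum f (γ '' Icc 0 1) n ε ≤ ⌊n * L / ε⌋₊ + 1 := by
  classical
  have h0 : (0 : ℝ) ∈ Icc (0 : ℝ) 1 := by simp
  have hbv : ∀ i, LocallyBoundedVariationOn (f^[i] ∘ γ) (Icc (0 : ℝ) 1) := fun i =>
    BoundedVariationOn.locallyBoundedVariationOn
      (ne_top_of_le_ne_top ENNReal.ofReal_ne_top (hbound i))
  let V : ℝ → ℝ := fun t =>
    ∑ i ∈ Finset.range n, variationOnFromTo (f^[i] ∘ γ) (Icc (0 : ℝ) 1) 0 t
  have hV0 : ∀ t ∈ Icc (0 : ℝ) 1, 0 ≤ V t := fun t ht =>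
    Finset.sum_nonneg fun i _ => variationOnFromTo.nonneg_of_le _ _ ht.1
  have hVL : ∀ t ∈ Icc (0 : ℝ) 1, V t ≤ n * L := by
    intro t ht
    have : V t ≤ ∑ _i ∈ Finset.range n, L := by
      refine Finset.sum_le_sum fun i _ => ?_
      rw [variationOnFromTo.eq_of_le _ _ ht.1]
      exact ENNReal.toReal_le_of_le_ofReal hL
        ((eVariationOn.mono _ inter_subset_left).trans (hbound i))
    simpa using this
  have hVdist : ∀ s ∈ Icc (0 : ℝ) 1, ∀ t ∈ Icc (0 : ℝ) 1, s ≤ t → ∀ i < n,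
      dist (f^[i] (γ s)) (f^[i] (γ t)) ≤ V t - V s := by
    intro s hs t ht hst i hi
    have hd := fun j => (hbv j).dist_le_variationOnFromTo_sub h0 hs ht hst
    rw [← Finset.sum_sub_distrib]
    exact (hd i).trans (Finset.single_le_sum (f := fun j =>
      variationOnFromTo (f^[j] ∘ γ) (Icc (0 : ℝ) 1) 0 t -
        variationOnFromTo (f^[j] ∘ γ) (Icc (0 : ℝ) 1) 0 s)
      (fun j _ => dist_nonneg.trans (hd j)) (Finset.mem_range.2 hi))
  have hVdist' : ∀ s ∈ Icc (0 : ℝ) 1, ∀ t ∈ Icc (0 : ℝ) 1, ∀ i < n,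
      dist (f^[i] (γ s)) (f^[i] (γ t)) ≤ |V t - V s| := by
    intro s hs t ht i hi
    rcases le_total s t with h | h
    · exact (hVdist s hs t ht h i hi).trans (le_abs_self _)
    · rw [dist_comm, abs_sub_comm]
      exact (hVdist t ht s hs h i hi).trans (le_abs_self _)
  have hrep : ∀ k : ℕ, ∃ x : X, ∀ t ∈ Icc (0 : ℝ) 1, ⌊V t / ε⌋₊ = k →
      ∀ i < n, dist (f^[i] x) (f^[i] (γ t)) < ε := by
    intro k
    by_cases hk : ∃ s ∈ Icc (0 : ℝ) 1, ⌊V s / ε⌋₊ = k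
    · obtain ⟨s, hs, hsk⟩ := hk
      refine ⟨γ s, fun t ht htk i hi => (hVdist' s hs t ht i hi).trans_lt ?_⟩
      have hs1 := (Nat.floor_eq_iff (div_nonneg (hV0 s hs) hε.le)).1 hsk
      have ht1 := (Nat.floor_eq_iff (div_nonneg (hV0 t ht) hε.le)).1 htk
      rw [le_div_iff₀ hε, div_lt_iff₀ hε] at hs1 ht1
      rw [abs_lt]
      constructor <;> linarith
    · exact ⟨γ 0, fun t ht htk => (hk ⟨t, ht, htk⟩).elim⟩
  choose r hr using hrep
  let F : Finset X := (Finset.range (⌊n * L / ε⌋₊ + 1)).image r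
  have hF : Spans f (γ '' Icc 0 1) F n ε := by
    rintro _ ⟨t, ht, rfl⟩
    refine ⟨r ⌊V t / ε⌋₊, Finset.mem_image_of_mem r (Finset.mem_range.2 ?_), hr _ t ht rfl⟩
    have := hVL t ht
    exact Nat.lt_succ_of_le (Nat.floor_mono (by gcongr))
  have hcard : F.card ≤ ⌊n * L / ε⌋₊ + 1 := by
    simpa using Finset.card_image_le (s := Finset.range (⌊n * L / ε⌋₊ + 1)) (f := r)
  exact le_trans (Nat.sInf_le ⟨F, hF, rfl⟩) hcard

theorem tendsto_log_div_natCast_of_le_linear {u : ℕ → ℕ} {C : ℝ} (hC : 0 ≤ C)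
    (hu : ∀ n : ℕ, (u n : ℝ) ≤ C * n + 1) :
    Tendsto (fun n : ℕ => Real.log (u n) / n) atTop (nhds 0) := by
  have hlog : Tendsto (fun n : ℕ => Real.log n / (n : ℝ)) atTop (nhds 0) :=
    Real.isLittleO_log_id_atTop.tendsto_div_nhds_zero.comp tendsto_natCast_atTop_atTop
  have hlim : Tendsto (fun n : ℕ => Real.log (C + 1) / (n : ℝ) + Real.log n / n) atTop
      (nhds 0) := by
    simpa using (tendsto_const_div_atTop_nhds_zero_nat (Real.log (C + 1))).add hlog
  refine tendsto_of_tendsto_of_tendsto_of_le_of_le' tendsto_const_nhds hlim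
    (Eventually.of_forall fun n => div_nonneg (Real.log_natCast_nonneg _) n.cast_nonneg) ?_
  filter_upwards [eventually_ge_atTop 1] with n hn
  have hn1 : (1 : ℝ) ≤ n := by exact_mod_cast hn
  rw [← add_div, ← Real.log_mul (by positivity) (by positivity)]
  gcongr ?_ / _
  rcases Nat.eq_zero_or_pos (u n) with h | h
  · simpa [h] using Real.log_nonneg (by nlinarith : (1 : ℝ) ≤ (C + 1) * n)
  · exact Real.log_le_log (by exact_mod_cast h) ((hu n).trans (by linarith))

/-- If `f` is uniformly continuous and the total variations of the paths `f^n ∘ γ`,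
`n ≥ 0`, are uniformly bounded, then the topological entropy of `f` on the image `I`
of `γ` is zero. -/
theorem stmt1 {X : Type*} [MetricSpace X] (f : X → X) (hf : UniformContinuous f)
    (γ : ℝ → X) (hγ : ContinuousOn γ (Icc 0 1)) (I : Set X) (hI : I = γ '' Icc 0 1)
    (hbound : ∃ L > (0 : ℝ), ∀ n : ℕ,
      eVariationOn (f^[n] ∘ γ) (Icc 0 1) ≤ ENNReal.ofReal L) :
    entropyOn f I = 0 := by
  obtain ⟨L, hL, hbound⟩ := hbound
  subst hI
  have hlimsup : ∀ ε : ℝ, 0 < ε → atTop.limsup (fun n : ℕ =>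
      ((Real.log (spanNum f (γ '' Icc 0 1) n ε) / n : ℝ) : EReal)) = 0 := by
    intro ε hε
    have hle : ∀ n : ℕ, (spanNum f (γ '' Icc 0 1) n ε : ℝ) ≤ L / ε * n + 1 := by
      intro n
      have h : (spanNum f (γ '' Icc 0 1) n ε : ℝ) ≤ (⌊n * L / ε⌋₊ : ℝ) + 1 := by
        exact_mod_cast spanNum_le_of_eVariationOn_le f γ hL.le hbound n hε
      have hfloor : (⌊n * L / ε⌋₊ : ℝ) ≤ n * L / ε := Nat.floor_le (by positivity)
      calc _ ≤ (n * L / ε : ℝ) + 1 := by linarith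
        _ = _ := by ring
    exact (EReal.tendsto_coe.2
      (tendsto_log_div_natCast_of_le_linear (by positivity) hle)).limsup_eq
  unfold entropyOn
  refine le_antisymm (iSup₂_le fun ε hε => (hlimsup ε hε).le) ?_
  exact (hlimsup 1 one_pos).ge.trans
    (le_iSup₂ (f := fun (ε : ℝ) (_ : 0 < ε) => atTop.limsup fun n : ℕ =>
      ((Real.log (spanNum f (γ '' Icc 0 1) n ε) / n : ℝ) : EReal)) 1 one_pos)
end

section
/- Let (X,d) be a compact metric space and f : X → X a homeomorphism. Let G₀ ⊆ X be a compact set with h(f, G₀) = 0, and set G∞ = ⋃_{n≥0} f^n(G₀). Suppose there are constants C ≥ 1 and C' ≥ 1 and, for each y ∈ G∞, a map h_y : [0,1] → X such that: (a) C⁻¹|s−t| ≤ d(h_y(s), h_y(t)) ≤ C|s−t| for all s,t ∈ [0,1] (uniformly bi-Lipschitz parametrizations); (b) y ∈ h_y([0,1]); (c) for every n ≥ 0 and all distinct y, y' ∈ f^n(G₀), the images h_y([0,1]) and h_{y'}([0,1]) are disjoint, and h_y([0,1]) ∩ f^n(G₀) = {y}; (d) f(h_y([0,1])) = h_{f(y)}([0,1])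 for every y ∈ G∞ (f-invariance of the family of curves); (e) for every ε > 0 there exists δ > 0 such that whenever y, y' ∈ G∞ satisfy d(y,y') < δ, one has sup_{t∈[0,1]} d(h_y(t), h_{y'}(t)) < ε (uniform continuity of the family); (f) d(f(h_y(s)), f(h_y(t))) ≤ C'·d(h_y(s), h_y(t)) for all y ∈ G∞ and all s,t ∈ [0,1] (f is uniformly Lipschitz along the curves). Then the compact set G = ⋃_{y∈G₀} h_y([0,1]) satisfies h(f, G) = 0. -/
open Set Filter

lemma mapsTo_iterate_curve {X : Type*} {f : X → X} {Y : Set X} (hY : MapsTo f Y Y) {h : X → ℝ → X}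
    {I : Set ℝ} (hmaps : ∀ y ∈ Y, MapsTo f (h y '' I) (h (f y) '' I)) (n : ℕ) {y : X}
    (hy : y ∈ Y) : MapsTo f^[n] (h y '' I) (h (f^[n] y) '' I) := by
  induction n generalizing y with
  | zero => exact mapsTo_id _
  | succ n ih => exact (ih (hY hy)).comp (hmaps y hy)

section EntropyLemmas

variable {X : Type*} [MetricSpace X]

lemma spanNum_le_card {f : X → X} {K : Set X} {F : Finset X} {n : ℕ} {ε : ℝ}
    (hF : Spans f K F n ε) : spanNum f K n ε ≤ F.card :=
  Nat.sInf_le ⟨F, hF, rfl⟩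

/-- On a compact space every set is spanned by a finite set. -/
lemma exists_spans [CompactSpace X] {f : X → X} (hf : Continuous f) (K : Set X) (n : ℕ)
    {ε : ℝ} (hε : 0 < ε) : ∃ F : Finset X, Spans f K F n ε := by
  have hU : ∀ x : X, {y | ∀ i < n, dist (f^[i] x) (f^[i] y) < ε} ∈ nhds x := by
    intro x
    refine (eventually_all_finite (Set.finite_lt_nat n)).2 fun i _ ↦ ?_
    have hc : Continuous fun y ↦ dist (f^[i] x) (f^[i] y) :=
      continuous_const.dist (hf.iterate i)
    exact hc.continuousAt.eventually_lt continuousAt_const (by simpa using hε)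
  obtain ⟨F, -, hF⟩ := isCompact_univ.elim_nhds_subcover _ fun x _ ↦ hU x
  refine ⟨F, fun y _ ↦ ?_⟩
  simpa using hF (mem_univ y)

/-- A minimal spanning set exists on a compact space. -/
lemma exists_spans_card_eq [CompactSpace X] {f : X → X} (hf : Continuous f) (K : Set X) (n : ℕ)
    {ε : ℝ} (hε : 0 < ε) : ∃ F : Finset X, Spans f K F n ε ∧ F.card = spanNum f K n ε := by
  obtain ⟨F, hF⟩ := exists_spans hf K n hε
  exact Nat.sInf_mem (s := {m : ℕ | ∃ F : Finset X, Spans f K F n ε ∧ F.card = m})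
    ⟨F.card, F, hF, rfl⟩

/-- If points of `K` carry labels in a finite type so that equally labelled points stay
`ε`-close for `n` steps, then the number of labels bounds the spanning number. -/
lemma spanNum_le_card_of_labels {ι : Type*} [Fintype ι] {f : X → X} {K : Set X} {n : ℕ} {ε : ℝ}
    (c : K → ι)
    (hc : ∀ x y : K, c x = c y → ∀ i < n, dist (f^[i] (x : X)) (f^[i] (y : X)) < ε) :
    spanNum f K n ε ≤ Fintype.card ι := by
  classical
  rcases isEmpty_or_nonempty K with hK | hK
  · refine (spanNum_le_card (F := ∅) fun y hy ↦ (hK.false ⟨y, hy⟩).elim).trans (by simp)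
  let F : Finset X := Finset.univ.image fun a : ι ↦ ((Function.invFun c a : K) : X)
  have hF : Spans f K F n ε := fun y hy ↦
    ⟨(Function.invFun c (c ⟨y, hy⟩) : K), Finset.mem_image_of_mem _ (Finset.mem_univ _),
      hc _ ⟨y, hy⟩ (Function.invFun_eq ⟨⟨y, hy⟩, rfl⟩)⟩
  exact (spanNum_le_card hF).trans Finset.card_image_le

/-- Finitely many monotone self-maps of `[0,1]` admit a common partition of `[0,1]` into at most
`m * k + 1` classes on each of which every map oscillates by less than `1 / k`. -/
lemma exists_labels_of_monotoneOn (m k : ℕ) (ψ : ℕ → ℝ → ℝ)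
    (hmono : ∀ i, MonotoneOn (ψ i) (Icc 0 1)) (hmaps : ∀ i, MapsTo (ψ i) (Icc 0 1) (Icc 0 1)) :
    ∃ c : ℝ → ℕ, (∀ t ∈ Icc (0 : ℝ) 1, c t < m * k + 1) ∧
      ∀ s ∈ Icc (0 : ℝ) 1, ∀ t ∈ Icc (0 : ℝ) 1, c s = c t →
        ∀ i < m, k * |ψ i s - ψ i t| < 1 := by
  have hk : (0 : ℝ) ≤ k := Nat.cast_nonneg k
  refine ⟨fun t ↦ ∑ i ∈ Finset.range m, ⌊k * ψ i t⌋₊, fun t ht ↦ Nat.lt_succ_of_le ?_, ?_⟩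
  · refine (Finset.sum_le_card_nsmul _ _ k fun i _ ↦ ?_).trans (by simp)
    exact Nat.floor_le_of_le (mul_le_of_le_one_right hk (hmaps i ht).2)
  · have key : ∀ s ∈ Icc (0 : ℝ) 1, ∀ t ∈ Icc (0 : ℝ) 1, s ≤ t →
        (∑ i ∈ Finset.range m, ⌊k * ψ i s⌋₊) = (∑ i ∈ Finset.range m, ⌊k * ψ i t⌋₊) →
        ∀ i < m, k * |ψ i s - ψ i t| < 1 := by
      intro s hs t ht hst heq i hi
      have hfl := (Finset.sum_eq_sum_iff_of_le fun j _ ↦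
        Nat.floor_le_floor (mul_le_mul_of_nonneg_left (hmono j hs ht hst) hk)).1 heq i
          (Finset.mem_range.2 hi)
      have h1 := Nat.floor_le (mul_nonneg hk (hmaps i hs).1)
      have h2 := Nat.lt_floor_add_one (k * ψ i t)
      rw [← hfl] at h2
      rw [abs_sub_comm, abs_of_nonneg (sub_nonneg.2 (hmono i hs ht hst))]
      linarith
    intro s hs t ht heq i hi
    rcases le_total s t with hst | hst
    · exact key s hs t ht hst heq i hi
    · rw [abs_sub_comm]
      exact key t ht s hs hst heq.symm i hi

/-- An injective continuous map between bi-Lipschitz arcs is, up to reversing orientation,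
monotone in the parameters. -/
lemma exists_monotoneOn_reparam {g : X → X} (hg : Continuous g) (hinj : Function.Injective g)
    {C : ℝ} (hC : 0 < C) {γ γ' : ℝ → X}
    (hγ : ∀ s ∈ Icc (0 : ℝ) 1, ∀ t ∈ Icc (0 : ℝ) 1,
      C⁻¹ * |s - t| ≤ dist (γ s) (γ t) ∧ dist (γ s) (γ t) ≤ C * |s - t|)
    (hγ' : ∀ s ∈ Icc (0 : ℝ) 1, ∀ t ∈ Icc (0 : ℝ) 1,
      C⁻¹ * |s - t| ≤ dist (γ' s) (γ' t) ∧ dist (γ' s) (γ' t) ≤ C * |s - t|)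
    (hmaps : MapsTo g (γ '' Icc 0 1) (γ' '' Icc 0 1)) :
    ∃ ψ : ℝ → ℝ, MonotoneOn ψ (Icc 0 1) ∧ MapsTo ψ (Icc 0 1) (Icc 0 1) ∧
      ∀ s ∈ Icc (0 : ℝ) 1, ∀ t ∈ Icc (0 : ℝ) 1,
        dist (g (γ s)) (g (γ t)) ≤ C * |ψ s - ψ t| := by
  have hex : ∀ t : ℝ, ∃ s : ℝ, t ∈ Icc (0 : ℝ) 1 → s ∈ Icc (0 : ℝ) 1 ∧ γ' s = g (γ t) := by
    intro t
    by_cases ht : t ∈ Icc (0 : ℝ) 1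
    · obtain ⟨s, hs, hst⟩ := hmaps (mem_image_of_mem γ ht)
      exact ⟨s, fun _ ↦ ⟨hs, hst⟩⟩
    · exact ⟨0, fun h ↦ (ht h).elim⟩
  choose φ hφ using hex
  have hγc : ContinuousOn γ (Icc 0 1) := by
    refine LipschitzOnWith.continuousOn (K := C.toNNReal) (LipschitzOnWith.of_dist_le_mul ?_)
    intro s hs t ht
    rw [Real.coe_toNNReal _ hC.le, Real.dist_eq]
    exact (hγ s hs t ht).2
  have hφd : ∀ s ∈ Icc (0 : ℝ) 1, ∀ t ∈ Icc (0 : ℝ) 1,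
      dist (φ s) (φ t) ≤ C * dist (g (γ s)) (g (γ t)) := by
    intro s hs t ht
    have h1 := (hγ' _ (hφ s hs).1 _ (hφ t ht).1).1
    rwa [(hφ s hs).2, (hφ t ht).2, inv_mul_le_iff₀ hC] at h1
  have hφc : ContinuousOn φ (Icc 0 1) := by
    intro s hs
    have hgc : Tendsto (fun t ↦ C * dist (g (γ t)) (g (γ s))) (nhdsWithin s (Icc 0 1))
        (nhds 0) := by
      have h1 : Tendsto (fun t ↦ dist (g (γ t)) (g (γ s))) (nhdsWithin s (Icc 0 1)) (nhds 0) :=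
        tendsto_iff_dist_tendsto_zero.1 (hg.comp_continuousOn hγc s hs)
      simpa using h1.const_mul C
    refine tendsto_iff_dist_tendsto_zero.2
      (squeeze_zero' (Eventually.of_forall fun _ ↦ dist_nonneg) ?_ hgc)
    filter_upwards [self_mem_nhdsWithin] with t ht using hφd t ht s hs
  have hφi : InjOn φ (Icc 0 1) := by
    intro s hs t ht hst
    have h1 : γ s = γ t := hinj (by rw [← (hφ s hs).2, ← (hφ t ht).2, hst])
    have h2 := (hγ s hs t ht).1
    rw [h1, dist_self, inv_mul_le_iff₀ hC, mul_zero] at h2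
    exact sub_eq_zero.1 (abs_nonpos_iff.1 h2)
  have hφL : ∀ s ∈ Icc (0 : ℝ) 1, ∀ t ∈ Icc (0 : ℝ) 1,
      dist (g (γ s)) (g (γ t)) ≤ C * |φ s - φ t| := by
    intro s hs t ht
    have h1 := (hγ' _ (hφ s hs).1 _ (hφ t ht).1).2
    rwa [(hφ s hs).2, (hφ t ht).2] at h1
  rcases hφc.strictMonoOn_of_injOn_Icc' zero_le_one hφi with hm | hm
  · exact ⟨φ, hm.monotoneOn, fun t ht ↦ (hφ t ht).1, hφL⟩
  · refine ⟨fun t ↦ 1 - φ t, fun s hs t ht hst ↦ sub_le_sub_left (hm.antitoneOn hs ht hst) _,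
      fun t ht ↦ ?_, fun s hs t ht ↦ ?_⟩
    · have h1 := (hφ t ht).1
      exact ⟨sub_nonneg.2 h1.2, sub_le_self _ h1.1⟩
    · rw [sub_sub_sub_cancel_left, abs_sub_comm]
      exact hφL s hs t ht

/-- Replacing a spanning set of `K` by one inside `K` at the cost of doubling the radius. -/
lemma Spans.exists_subset {f : X → X} {K : Set X} {F : Finset X} {n : ℕ} {δ : ℝ}
    (hF : Spans f K F n δ) :
    ∃ F' : Finset X, (F' : Set X) ⊆ K ∧ F'.card ≤ F.card ∧ Spans f K F' n (2 * δ) := by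
  classical
  have hex : ∀ z : X, ∃ p : X, (∃ y ∈ K, ∀ i < n, dist (f^[i] z) (f^[i] y) < δ) →
      p ∈ K ∧ ∀ i < n, dist (f^[i] z) (f^[i] p) < δ := by
    intro z
    by_cases hz : ∃ y ∈ K, ∀ i < n, dist (f^[i] z) (f^[i] y) < δ
    · obtain ⟨y, hy⟩ := hz
      exact ⟨y, fun _ ↦ hy⟩
    · exact ⟨z, fun h ↦ (hz h).elim⟩
  choose p hp using hex
  refine ⟨(F.filter fun z ↦ ∃ y ∈ K, ∀ i < n, dist (f^[i] z) (f^[i] y) < δ).image p, ?_,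
    Finset.card_image_le.trans (Finset.card_filter_le _ _), fun y hy ↦ ?_⟩
  · intro x hx
    obtain ⟨z, hz, rfl⟩ := Finset.mem_image.1 (Finset.mem_coe.1 hx)
    exact (hp z (Finset.mem_filter.1 hz).2).1
  · obtain ⟨z, hzF, hz⟩ := hF y hy
    refine ⟨p z, Finset.mem_image_of_mem _ (Finset.mem_filter.2 ⟨hzF, y, hy, hz⟩), fun i hi ↦ ?_⟩
    have h1 := dist_triangle_left (f^[i] (p z)) (f^[i] y) (f^[i] z)
    have h2 := (hp z ⟨y, hy, hz⟩).2 i hi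
    have h3 := hz i hi
    linarith

/-- A curve of an invariant family of uniformly bi-Lipschitz arcs has linear orbit complexity. -/
lemma exists_curve_labels {f : X → X} (hf : Continuous f) (hinj : Function.Injective f)
    {Y : Set X} (hY : MapsTo f Y Y) {C : ℝ} (hC : 0 < C) {h : X → ℝ → X}
    (hbi : ∀ y ∈ Y, ∀ s ∈ Icc (0 : ℝ) 1, ∀ t ∈ Icc (0 : ℝ) 1,
      C⁻¹ * |s - t| ≤ dist (h y s) (h y t) ∧ dist (h y s) (h y t) ≤ C * |s - t|)
    (hmaps : ∀ y ∈ Y, MapsTo f (h y '' Icc 0 1) (h (f y) '' Icc 0 1))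
    {ε : ℝ} {k : ℕ} (hk : C < ε * k) (m : ℕ) {y : X} (hy : y ∈ Y) :
    ∃ c : ℝ → ℕ, (∀ t ∈ Icc (0 : ℝ) 1, c t < m * k + 1) ∧
      ∀ s ∈ Icc (0 : ℝ) 1, ∀ t ∈ Icc (0 : ℝ) 1, c s = c t →
        ∀ i < m, dist (f^[i] (h y s)) (f^[i] (h y t)) < ε := by
  have hψ := fun i : ℕ ↦ exists_monotoneOn_reparam (hf.iterate i) (hinj.iterate i) hC (hbi y hy)
    (hbi _ (hY.iterate i hy)) (mapsTo_iterate_curve hY hmaps i hy)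
  choose ψ hmono hψm hψd using hψ
  obtain ⟨c, hc, hcc⟩ := exists_labels_of_monotoneOn m k ψ hmono hψm
  refine ⟨c, hc, fun s hs t ht hst i hi ↦ ?_⟩
  have h1 := hcc s hs t ht hst i hi
  have h2 := hψd i s hs t ht
  have hk0 : (0 : ℝ) < k := by
    rcases (Nat.cast_nonneg k : (0 : ℝ) ≤ k).eq_or_lt with h0 | h0
    · rw [← h0, mul_zero] at hk
      exact absurd hk hC.not_gt
    · exact h0
  refine lt_of_mul_lt_mul_right (a := (k : ℝ)) ?_ hk0.le
  calc dist (f^[i] (h y s)) (f^[i] (h y t)) * k ≤ C * |ψ i s - ψ i t| * k := by gcongr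
    _ = C * (k * |ψ i s - ψ i t|) := by ring
    _ ≤ C * 1 := by gcongr
    _ < ε * k := by linarith

/-- Finitely many iterates of a continuous self-map of a compact space are jointly uniformly
continuous. -/
lemma exists_dist_iterate_lt [CompactSpace X] {f : X → X} (hf : Continuous f) (m : ℕ) {ε : ℝ}
    (hε : 0 < ε) :
    ∃ δ > 0, ∀ a b : X, dist a b < δ → ∀ i < m, dist (f^[i] a) (f^[i] b) < ε := by
  induction m with
  | zero => exact ⟨1, one_pos, by simp⟩
  | succ m ih =>
    obtain ⟨δ, hδ, hm⟩ := ih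
    obtain ⟨δ', hδ', hm'⟩ := Metric.uniformContinuous_iff.1
      (CompactSpace.uniformContinuous_of_continuous (hf.iterate m)) ε hε
    refine ⟨min δ δ', lt_min hδ hδ', fun a b hab i hi ↦ ?_⟩
    rcases Nat.lt_succ_iff_lt_or_eq.1 hi with hi | rfl
    · exact hm a b (hab.trans_le (min_le_left _ _)) i hi
    · exact hm' (hab.trans_le (min_le_right _ _))

/-- Spanning numbers of a union of curves, compared with those of the set of base points:
each block of `m` iterates costs a factor `m * k + 1`. -/
lemma exists_spanNum_iUnion_curve_le [CompactSpace X] {f : X → X} (hf : Continuous f)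
    (hinj : Function.Injective f)
    {Y : Set X} (hY : MapsTo f Y Y) {C : ℝ} (hC : 0 < C) {h : X → ℝ → X}
    (hbi : ∀ y ∈ Y, ∀ s ∈ Icc (0 : ℝ) 1, ∀ t ∈ Icc (0 : ℝ) 1,
      C⁻¹ * |s - t| ≤ dist (h y s) (h y t) ∧ dist (h y s) (h y t) ≤ C * |s - t|)
    (hmaps : ∀ y ∈ Y, MapsTo f (h y '' Icc 0 1) (h (f y) '' Icc 0 1))
    (hunif : ∀ ε > (0 : ℝ), ∃ δ > (0 : ℝ), ∀ y ∈ Y, ∀ y' ∈ Y, dist y y' < δ →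
      ∀ t ∈ Icc (0 : ℝ) 1, dist (h y t) (h y' t) < ε)
    {K : Set X} (hK : K ⊆ Y) {ε : ℝ} (hε : 0 < ε) {k : ℕ} (hk : C < ε * k) {m : ℕ} (hm : 0 < m) :
    ∃ δ > 0, ∀ n : ℕ, spanNum f (⋃ y ∈ K, h y '' Icc (0 : ℝ) 1) n (3 * ε) ≤
      spanNum f K n δ * (m * k + 1) ^ (n / m + 1) := by
  obtain ⟨ε', hε', hfε⟩ := exists_dist_iterate_lt hf m hε
  obtain ⟨δ, hδ, hhδ⟩ := hunif ε' hε'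
  refine ⟨δ / 2, half_pos hδ, fun n ↦ ?_⟩
  obtain ⟨F₀, hF₀, hF₀card⟩ := exists_spans_card_eq hf K n (half_pos hδ)
  obtain ⟨F, hFK, hFcard, hF⟩ := hF₀.exists_subset
  rw [mul_div_cancel₀ δ two_ne_zero] at hF
  have hlab := fun y : Y ↦ exists_curve_labels hf hinj hY hC hbi hmaps hk m y.2
  choose c hcb hc using hlab
  have hpt : ∀ x : (⋃ y ∈ K, h y '' Icc (0 : ℝ) 1 : Set X), ∃ z : F, ∃ τ : ℕ → ℝ,
      (∀ j, τ j ∈ Icc (0 : ℝ) 1) ∧ ∀ j, j * m < n → ∀ r < m,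
        dist (f^[j * m + r] (x : X)) (f^[r] (h (f^[j * m] z) (τ j))) < ε := by
    rintro ⟨x, hx⟩
    obtain ⟨y, hy, hxy⟩ := mem_iUnion₂.1 hx
    obtain ⟨z, hzF, hz⟩ := hF y hy
    have hτ := fun j : ℕ ↦ mapsTo_iterate_curve hY hmaps (j * m) (hK hy) hxy
    choose τ hτ hτx using hτ
    refine ⟨⟨z, hzF⟩, τ, hτ, fun j hj r hr ↦ ?_⟩
    rw [add_comm, Function.iterate_add_apply, ← hτx j, dist_comm]
    exact hfε _ _ (hhδ _ (hY.iterate _ (hK (hFK hzF))) _ (hY.iterate _ (hK hy)) (hz _ hj) _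
      (hτ j)) r hr
  choose z τ hτ hzτ using hpt
  have hzY : ∀ x j, f^[j * m] (z x : X) ∈ Y := fun x j ↦ hY.iterate _ (hK (hFK (z x).2))
  have hle := spanNum_le_card_of_labels (f := f) (n := n) (ε := 3 * ε)
    (ι := F × (Fin (n / m + 1) → Fin (m * k + 1)))
    (K := ⋃ y ∈ K, h y '' Icc (0 : ℝ) 1)
    (fun x ↦ (z x, fun j ↦ ⟨c ⟨_, hzY x j⟩ (τ x j), hcb _ _ (hτ x j)⟩)) ?_
  · refine hle.trans ?_
    simp only [Fintype.card_prod, Fintype.card_coe, Fintype.card_fun, Fintype.card_fin]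
    gcongr
    exact hFcard.trans hF₀card.le
  · intro x x' hxx i hi
    obtain ⟨hz1, hz2⟩ := Prod.mk.inj hxx
    have hjn : i / m * m ≤ i := Nat.div_mul_le_self i m
    have hj : i / m < n / m + 1 := Nat.lt_succ_of_le (Nat.div_le_div_right hi.le)
    have hcj := congrArg Fin.val (congrFun hz2 ⟨i / m, hj⟩)
    have hr : i % m < m := Nat.mod_lt i hm
    have h1 := hzτ x (i / m) (hjn.trans_lt hi) (i % m) hr
    have h2 := hzτ x' (i / m) (hjn.trans_lt hi) (i % m) hr
    rw [Nat.div_add_mod'] at h1 h2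
    simp only [hz1] at hcj h1
    have h3 := hc _ _ (hτ x _) _ (hτ x' _) hcj _ hr
    have h4 := dist_triangle4_right (f^[i] (x : X)) (f^[i] (x' : X))
      (f^[i % m] (h (f^[i / m * m] (z x' : X)) (τ x (i / m))))
      (f^[i % m] (h (f^[i / m * m] (z x' : X)) (τ x' (i / m))))
    linarith

lemma entropyOn_nonneg (f : X → X) (K : Set X) : 0 ≤ entropyOn f K := by
  refine le_iSup₂_of_le 1 one_pos (le_limsup_of_frequently_le ?_)
  exact Frequently.of_forall fun n ↦ EReal.coe_nonneg.2 <|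
    div_nonneg (Real.log_natCast_nonneg _) (Nat.cast_nonneg _)

lemma entropyOn_nonpos_of_eventually_le {f : X → X} {K : Set X}
    (hK : ∀ ε > 0, ∀ η > 0, ∀ᶠ n : ℕ in atTop, Real.log (spanNum f K n ε) / n ≤ η) :
    entropyOn f K ≤ 0 := by
  refine iSup₂_le fun ε hε ↦ ?_
  refine EReal.le_of_forall_lt_iff_le.1 fun η hη ↦ limsup_le_of_le (h := ?_)
  filter_upwards [hK ε hε η (EReal.coe_pos.1 hη)] with n hn
  exact EReal.coe_le_coe_iff.2 hn

lemma eventually_log_spanNum_div_lt {f : X → X} {K : Set X} (hK : entropyOn f K ≤ 0) {ε η : ℝ}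
    (hε : 0 < ε) (hη : 0 < η) : ∀ᶠ n : ℕ in atTop, Real.log (spanNum f K n ε) / n < η := by
  have h1 : (atTop.limsup fun n : ℕ ↦ ((Real.log (spanNum f K n ε) / n : ℝ) : EReal)) < η :=
    ((le_iSup₂_of_le ε hε le_rfl).trans hK).trans_lt (EReal.coe_pos.2 hη)
  filter_upwards [eventually_lt_of_limsup_lt h1] with n hn
  exact EReal.coe_lt_coe_iff.1 hn

lemma exists_log_mul_add_one_div_lt (k : ℕ) {η : ℝ} (hη : 0 < η) :
    ∃ m : ℕ, 0 < m ∧ Real.log (m * k + 1) / m < η := by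
  have h1 : Tendsto (fun m : ℕ ↦ Real.log m / m) atTop (nhds 0) :=
    Real.isLittleO_log_id_atTop.tendsto_div_nhds_zero.comp tendsto_natCast_atTop_atTop
  have h2 : Tendsto (fun m : ℕ ↦ Real.log (k + 1) / m) atTop (nhds 0) :=
    tendsto_const_div_atTop_nhds_zero_nat _
  have h3 := (h1.add h2).eventually_lt_const (by simpa using hη)
  obtain ⟨m, hm, hm0⟩ := (h3.and (eventually_gt_atTop 0)).exists
  refine ⟨m, hm0, lt_of_le_of_lt ?_ hm⟩
  have hm1 : (1 : ℝ) ≤ m := by exact_mod_cast hm0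
  rw [← add_div, ← Real.log_mul (by positivity) (by positivity)]
  gcongr
  linarith

lemma log_div_le_of_le_mul_pow {a b q m n : ℕ} (hm : 0 < m) (hn : 0 < n) (hq : 0 < q)
    (hab : a ≤ b * q ^ (n / m + 1)) :
    Real.log a / n ≤ Real.log b / n + Real.log q / m + Real.log q / n := by
  have hn' : (0 : ℝ) < n := by exact_mod_cast hn
  have hlq : 0 ≤ Real.log q := Real.log_natCast_nonneg q
  have hlb : 0 ≤ Real.log b := Real.log_natCast_nonneg b
  have hlog : Real.log a ≤ Real.log b + ((n / m : ℕ) + 1) * Real.log q := by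
    rcases Nat.eq_zero_or_pos a with rfl | ha
    · simp only [Nat.cast_zero, Real.log_zero]
      positivity
    · have hb : b ≠ 0 := by
        rintro rfl
        omega
      calc Real.log a ≤ Real.log ((b * q ^ (n / m + 1) : ℕ) : ℝ) :=
            Real.log_le_log (by exact_mod_cast ha) (by exact_mod_cast hab)
        _ = _ := by
            push_cast
            rw [Real.log_mul (by exact_mod_cast hb) (by positivity), Real.log_pow]
            push_cast
            ring
  have hdiv : ((n / m : ℕ) : ℝ) ≤ n / m := Nat.cast_div_le
  calc Real.log a / n ≤ (Real.log b + ((n : ℝ) / m + 1) * Real.log q) / n := by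
        gcongr
        exact hlog.trans (by gcongr)
    _ = _ := by
        have hm' : (m : ℝ) ≠ 0 := by exact_mod_cast hm.ne'
        field_simp
        ring

end EntropyLemmas

/-- Inductive step of the bounded geometry theorem: attaching to a zero-entropy compact
set `G₀` a uniformly bi-Lipschitz, uniformly continuous, `f`-invariant family of curves
produces a set `G` which again has zero topological entropy. -/
theorem stmt2 {X : Type*} [MetricSpace X] [CompactSpace X] (f : X ≃ₜ X)
    (G₀ : Set X) (hG₀ : IsCompact G₀) (hent₀ : entropyOn (f : X → X) G₀ = 0)
    (C C' : ℝ) (hC : 1 ≤ C) (hC' : 1 ≤ C')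
    (h : X → ℝ → X)
    (Ginf : Set X) (hGinf : Ginf = ⋃ n : ℕ, (f : X → X)^[n] '' G₀)
    -- (a) uniformly bi-Lipschitz parametrizations
    (ha : ∀ y ∈ Ginf, ∀ s ∈ Icc (0:ℝ) 1, ∀ t ∈ Icc (0:ℝ) 1,
      C⁻¹ * |s - t| ≤ dist (h y s) (h y t) ∧ dist (h y s) (h y t) ≤ C * |s - t|)
    -- (b) the curve through `y` contains `y`
    (hb : ∀ y ∈ Ginf, y ∈ h y '' Icc (0:ℝ) 1)
    -- (c) the curves through distinct points of `f^n(G₀)` are disjoint, and each curve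
    -- meets `f^n(G₀)` exactly at its base point
    (hc₁ : ∀ n : ℕ, ∀ y ∈ (f : X → X)^[n] '' G₀, ∀ y' ∈ (f : X → X)^[n] '' G₀,
      y ≠ y' → Disjoint (h y '' Icc (0:ℝ) 1) (h y' '' Icc (0:ℝ) 1))
    (hc₂ : ∀ n : ℕ, ∀ y ∈ (f : X → X)^[n] '' G₀,
      (h y '' Icc (0:ℝ) 1) ∩ ((f : X → X)^[n] '' G₀) = {y})
    -- (d) `f`-invariance of the family of curves
    (hd : ∀ y ∈ Ginf, (f : X → X) '' (h y '' Icc (0:ℝ) 1) = h (f y) '' Icc (0:ℝ) 1)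
    -- (e) uniform continuity of the family
    (he : ∀ ε > (0:ℝ), ∃ δ > (0:ℝ), ∀ y ∈ Ginf, ∀ y' ∈ Ginf, dist y y' < δ →
      ∀ t ∈ Icc (0:ℝ) 1, dist (h y t) (h y' t) < ε)
    -- (f) `f` is uniformly Lipschitz along the curves
    (hLip : ∀ y ∈ Ginf, ∀ s ∈ Icc (0:ℝ) 1, ∀ t ∈ Icc (0:ℝ) 1,
      dist (f (h y s)) (f (h y t)) ≤ C' * dist (h y s) (h y t)) :
    entropyOn (f : X → X) (⋃ y ∈ G₀, h y '' Icc (0:ℝ) 1) = 0 := by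
  have hY : MapsTo f Ginf Ginf := by
    subst hGinf
    intro y hy
    obtain ⟨n, z, hz, rfl⟩ := mem_iUnion.1 hy
    exact mem_iUnion.2 ⟨n + 1, z, hz, Function.iterate_succ_apply' f n z⟩
  have hG₀Y : G₀ ⊆ Ginf := by
    subst hGinf
    exact fun y hy ↦ mem_iUnion.2 ⟨0, y, hy, rfl⟩
  have hC0 : 0 < C := one_pos.trans_le hC
  refine le_antisymm (entropyOn_nonpos_of_eventually_le fun ε hε η hη ↦ ?_) (entropyOn_nonneg _ _)
  have hε3 : 0 < ε / 3 := by positivity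
  have hη3 : 0 < η / 3 := by positivity
  obtain ⟨k, hk⟩ := exists_nat_gt (C / (ε / 3))
  rw [div_lt_iff₀' hε3] at hk
  obtain ⟨m, hm, hmη⟩ := exists_log_mul_add_one_div_lt k hη3
  obtain ⟨δ, hδ, hle⟩ := exists_spanNum_iUnion_curve_le f.continuous f.injective hY hC0 ha
    (fun y hy ↦ mapsTo_iff_image_subset.2 (hd y hy).subset) he hG₀Y hε3 hk hm
  have hlim := (tendsto_const_div_atTop_nhds_zero_nat
    (Real.log ((m * k + 1 : ℕ) : ℝ))).eventually_lt_const hη3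
  filter_upwards [eventually_log_spanNum_div_lt hent₀.le hδ hη3, hlim, eventually_gt_atTop 0]
    with n h1 h2 hn
  have h3 := log_div_le_of_le_mul_pow hm hn (Nat.succ_pos _) (hle n)
  rw [mul_div_cancel₀ ε three_ne_zero] at h3
  push_cast at h2 h3
  linarith
end
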